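/- arXiv:2011.04511 — 5 statements merged into one kernel-verified Lean document; each statement's English description precedes it below -/
import Mathlib

section
/- Let ℒ be a nonempty finite set, let Q ≥ 1 be an integer, let x : ℒ → ℝ satisfy x(ℓ) ≥ 0 for all ℓ, ∑_{ℓ∈ℒ} x(ℓ) = 1, and suppose each x(ℓ) is an integer multiple of 1/(2Q). Let W : ℒ → ℝ be non-negative weights. Then there exists x' : ℒ → ℝ with x'(ℓ) ≥ 0 for all ℓ, ∑_{ℓ∈ℒ} x'(ℓ) = 1, each x'(ℓ) an integer multiple of 1/Q, x'(ℓ) ≤ 2·x(ℓ) for every ℓ ∈ ℒ, and ∑_{ℓ∈ℒ} x'(ℓ)·W(ℓ) ≤ ∑_{ℓ∈ℒ} x(ℓ)·W(ℓ). -/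
/-- A finite set of even cardinality carries a balanced sign function whose pairing with `W` is
non-positive. -/
theorem exists_balanced_sign_sum_mul_nonpos {L : Type*} [Fintype L] (S : Finset L)
    (hS : Even S.card) (W : L → ℝ) :
    ∃ ε : L → ℤ, (∀ ℓ ∈ S, ε ℓ = 1 ∨ ε ℓ = -1) ∧ (∀ ℓ ∉ S, ε ℓ = 0) ∧
      ∑ ℓ, ε ℓ = 0 ∧ ∑ ℓ, (ε ℓ : ℝ) * W ℓ ≤ 0 := by
  classical
  obtain ⟨ε, h1, h0, hs⟩ : ∃ ε : L → ℤ, (∀ ℓ ∈ S, ε ℓ = 1 ∨ ε ℓ = -1) ∧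
      (∀ ℓ ∉ S, ε ℓ = 0) ∧ ∑ ℓ, ε ℓ = 0 := by
    obtain ⟨n, hn⟩ := hS
    obtain ⟨T, hTS, hT⟩ := Finset.exists_subset_card_eq (s := S) (n := n) (by omega)
    refine ⟨fun ℓ => 2 * (if ℓ ∈ T then 1 else 0) - (if ℓ ∈ S then 1 else 0), ?_, ?_, ?_⟩
    · intro ℓ hℓ
      by_cases h : ℓ ∈ T <;> simp [h, hℓ]
    · intro ℓ hℓ
      simp [hℓ, Finset.notMem_mono hTS hℓ]
    · simp [hT, hn, mul_two]
  rcases le_total (∑ ℓ, (ε ℓ : ℝ) * W ℓ) 0 with h | h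
  · exact ⟨ε, h1, h0, hs, h⟩
  · refine ⟨fun ℓ => -ε ℓ, fun ℓ hℓ => ?_, fun ℓ hℓ => by simp [h0 ℓ hℓ], by simp [hs], ?_⟩
    · rcases h1 ℓ hℓ with h | h <;> simp [h]
    · simpa using h

/-- Single-vertex rounding step. Given a `1/(2Q)`-integral probability
vector `x` on a nonempty finite label set and non-negative weights `W`, there exists a
`1/Q`-integral probability vector `x'` with `x' ℓ ≤ 2 * x ℓ` pointwise whose linear cost
`∑ ℓ, x' ℓ * W ℓ` does not exceed that of `x`. -/
theorem single_vertex_rounding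
    {L : Type*} [Fintype L] [Nonempty L]
    (Q : ℕ) (hQ : 1 ≤ Q)
    (x : L → ℝ) (hx0 : ∀ ℓ, 0 ≤ x ℓ) (hx1 : ∑ ℓ, x ℓ = 1)
    (hxint : ∀ ℓ, ∃ k : ℤ, x ℓ = (k : ℝ) / (2 * Q))
    (W : L → ℝ) (hW : ∀ ℓ, 0 ≤ W ℓ) :
    ∃ x' : L → ℝ,
      (∀ ℓ, 0 ≤ x' ℓ) ∧
      (∑ ℓ, x' ℓ = 1) ∧
      (∀ ℓ, ∃ k : ℤ, x' ℓ = (k : ℝ) / Q) ∧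
      (∀ ℓ, x' ℓ ≤ 2 * x ℓ) ∧
      ∑ ℓ, x' ℓ * W ℓ ≤ ∑ ℓ, x ℓ * W ℓ := by
  have hQ0 : (0 : ℝ) < Q := by exact_mod_cast hQ
  have hnat : ∀ ℓ, ∃ k : ℕ, x ℓ = (k : ℝ) / (2 * Q) := by
    intro ℓ
    obtain ⟨k, hk⟩ := hxint ℓ
    have hk0 : (0 : ℝ) ≤ k := by
      have h : (k : ℝ) = x ℓ * (2 * Q) := by rw [hk]; field_simp
      rw [h]
      exact mul_nonneg (hx0 ℓ) (by positivity)
    lift k to ℕ using (by exact_mod_cast hk0)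
    exact ⟨k, by simpa using hk⟩
  choose k hk using hnat
  have hksum : ∑ ℓ, k ℓ = 2 * Q := by
    simp only [hk, ← Finset.sum_div] at hx1
    rw [div_eq_one_iff_eq (by positivity)] at hx1
    exact_mod_cast hx1
  obtain ⟨ε, h1, h0, hs, hεW⟩ := exists_balanced_sign_sum_mul_nonpos
    (Finset.univ.filter fun ℓ => Odd (k ℓ))
    ((Finset.even_sum_iff_even_card_odd k).1 (hksum ▸ even_two_mul Q)) W
  simp only [Finset.mem_filter, Finset.mem_univ, true_and] at h1 h0
  have hround : ∀ ℓ, 0 ≤ (k ℓ : ℤ) + ε ℓ ∧ ε ℓ ≤ k ℓ ∧ ∃ m : ℤ, (k ℓ : ℤ) + ε ℓ = 2 * m := by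
    intro ℓ
    by_cases hodd : Odd (k ℓ)
    · obtain ⟨m, hm⟩ := hodd
      rcases h1 ℓ ⟨m, hm⟩ with h | h
      · exact ⟨by omega, by omega, m + 1, by omega⟩
      · exact ⟨by omega, by omega, m, by omega⟩
    · obtain ⟨m, hm⟩ := Nat.not_odd_iff_even.1 hodd
      have h := h0 ℓ hodd
      exact ⟨by omega, by omega, m, by omega⟩
  refine ⟨fun ℓ => x ℓ + (ε ℓ : ℝ) / (2 * Q), fun ℓ => ?_, ?_, fun ℓ => ?_, fun ℓ => ?_, ?_⟩
  · have h : (0 : ℝ) ≤ k ℓ + ε ℓ := by exact_mod_cast (hround ℓ).1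
    beta_reduce
    rw [hk, ← add_div]
    positivity
  · rw [Finset.sum_add_distrib, hx1, ← Finset.sum_div, ← Int.cast_sum, hs]
    simp
  · obtain ⟨m, hm⟩ := (hround ℓ).2.2
    have hm' : (k ℓ : ℝ) + ε ℓ = 2 * m := by exact_mod_cast hm
    refine ⟨m, ?_⟩
    beta_reduce
    rw [hk, ← add_div, hm', mul_div_mul_left _ _ two_ne_zero]
  · have h : (ε ℓ : ℝ) ≤ k ℓ := by exact_mod_cast (hround ℓ).2.1
    have h' : (ε ℓ : ℝ) / (2 * Q) ≤ x ℓ := by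
      rw [hk]
      gcongr
    linarith
  · simp only [add_mul, Finset.sum_add_distrib, div_mul_eq_mul_div, ← Finset.sum_div]
    linarith [div_nonpos_of_nonpos_of_nonneg hεW (by positivity : (0 : ℝ) ≤ 2 * Q)]
end

section
/- Let G = (V,E) be a finite simple graph, ℒ a nonempty finite label set, c : (V × ℒ)² → ℝ a non-negative edge cost function, and Q ≥ 1 an integer. Suppose x is a 1/(2Q)-integral fractional vertex labeling of G, i.e. for every v ∈ V and ℓ ∈ ℒ, x_{v,ℓ} ∈ [0,1] is an integer multiple of 1/(2Q) and ∑_{ℓ∈ℒ} x_{v,ℓ} = 1. Then there exists a 1/Q-integral fractional vertex labeling x' of G such that x'_{v,ℓ} ≤ 2·x_{v,ℓ} for all v ∈ V and ℓ ∈ ℒ, and the total edge cost of x' is at most the total edge cost of x, where the total edge cost of a fractional labeling y is defined as ∑_{{u,v}∈E} ∑_{(ℓ_u,ℓ_v)∈ℒ²} y_{u,ℓ_u} · y_{v,ℓ_v} · c((u,ℓ_u),(v,ℓ_v)). -/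
/-- A family of natural numbers with even sum admits a perturbation by a zero-sum family of
signs supported on the odd entries. -/
lemma exists_balanced_parity_correction {L : Type*} [Fintype L] (k : L → ℕ)
    (hk : Even (∑ ℓ, k ℓ)) :
    ∃ e : L → ℤ, ∑ ℓ, e ℓ = 0 ∧ (∀ ℓ, Even ((k ℓ : ℤ) + e ℓ)) ∧ ∀ ℓ, |e ℓ| ≤ k ℓ := by
  classical
  obtain ⟨m, hm⟩ := (Finset.even_sum_iff_even_card_odd k).mp hk
  obtain ⟨T, hT, hTm⟩ := Finset.exists_subset_card_eq (n := m)
    (s := Finset.univ.filter fun ℓ => Odd (k ℓ)) (by omega)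
  refine ⟨fun ℓ => (if ℓ ∈ T then 2 else 0) - if Odd (k ℓ) then 1 else 0, ?_, ?_, ?_⟩
  · rw [Finset.sum_sub_distrib, Finset.sum_ite_mem, Finset.univ_inter, Finset.sum_const,
      Finset.sum_boole, hm, hTm]
    push_cast
    simp
    ring
  all_goals
    intro ℓ
    have hmem : ℓ ∈ T → Odd (k ℓ) := fun h => (Finset.mem_filter.mp (hT h)).2
    by_cases ho : Odd (k ℓ)
    · by_cases ht : ℓ ∈ T <;> simp only [ho, ht, if_true, if_false] <;> grind
    · have ht : ℓ ∉ T := fun h => ho (hmem h)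
      simp [ho, ht, ← Nat.not_odd_iff_even]

/-- Method of conditional expectations: a function on `V → ℤ` satisfying the midpoint identity
between `1` and `-1` in each coordinate takes a value at most `F 0` at some sign vector. -/
lemma exists_sign_vector_le {V : Type*} [Fintype V] [DecidableEq V] (F : (V → ℤ) → ℝ)
    (hF : ∀ s v, F (Function.update s v 1) + F (Function.update s v (-1)) =
      2 * F (Function.update s v 0)) :
    ∃ s : V → ℤ, (∀ v, s v = 1 ∨ s v = -1) ∧ F s ≤ F 0 := by
  have key : ∀ S : Finset V, ∃ s : V → ℤ,
      (∀ v ∈ S, s v = 1 ∨ s v = -1) ∧ (∀ v ∉ S, s v = 0) ∧ F s ≤ F 0 := by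
    intro S
    induction S using Finset.induction_on with
    | empty => exact ⟨0, by simp, by simp, le_rfl⟩
    | insert w S hw ih =>
      obtain ⟨s, hs, hs0, hle⟩ := ih
      have hupd : Function.update s w 0 = s := by
        rw [← hs0 w hw, Function.update_eq_self]
      have h := hF s w
      rw [hupd] at h
      have extend : ∀ t : ℤ, t = 1 ∨ t = -1 → F (Function.update s w t) ≤ F 0 →
          ∃ s : V → ℤ, (∀ v ∈ insert w S, s v = 1 ∨ s v = -1) ∧
            (∀ v ∉ insert w S, s v = 0) ∧ F s ≤ F 0 := by
        intro t ht hFt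
        refine ⟨Function.update s w t, fun v hv => ?_, fun v hv => ?_, hFt⟩
        · rcases eq_or_ne v w with rfl | hvw
          · simpa using ht
          · rw [Function.update_of_ne hvw]
            exact hs v (Finset.mem_of_mem_insert_of_ne hv hvw)
        · rw [Finset.mem_insert, not_or] at hv
          rw [Function.update_of_ne hv.1]
          exact hs0 v hv.2
      rcases le_total (F (Function.update s w 1)) (F (Function.update s w (-1))) with h' | h'
      · exact extend 1 (Or.inl rfl) (by linarith)
      · exact extend (-1) (Or.inr rfl) (by linarith)
  obtain ⟨s, hs, -, hle⟩ := key Finset.univ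
  exact ⟨s, fun v => hs v (Finset.mem_univ v), hle⟩

/-- Basic Rounding Lemma (Lemma 3.5). Given a `1/(2Q)`-integral fractional
vertex labeling `x` of a finite simple graph and a non-negative (symmetric) edge cost
function `c`, there is a `1/Q`-integral fractional vertex labeling `x'` with
`x' v ℓ ≤ 2 * x v ℓ` for all `v, ℓ`, whose total edge cost
`∑_{{u,v} ∈ E} ∑_{a,b} x'_{u,a} x'_{v,b} c((u,a),(v,b))` (written as half the sum over
ordered adjacent pairs) is at most that of `x`. -/
theorem basic_rounding_lemma
    {V L : Type*} [Fintype V] [DecidableEq V] [Fintype L] [Nonempty L]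
    (G : SimpleGraph V) [DecidableRel G.Adj]
    (c : V × L → V × L → ℝ)
    (hc : ∀ p q, 0 ≤ c p q)
    (hcsymm : ∀ p q, c p q = c q p)
    (Q : ℕ) (hQ : 1 ≤ Q)
    (x : V → L → ℝ)
    (hx0 : ∀ v ℓ, 0 ≤ x v ℓ) (hx1 : ∀ v ℓ, x v ℓ ≤ 1)
    (hxsum : ∀ v, ∑ ℓ, x v ℓ = 1)
    (hxint : ∀ v ℓ, ∃ k : ℤ, x v ℓ = (k : ℝ) / (2 * Q)) :
    ∃ x' : V → L → ℝ,
      (∀ v ℓ, 0 ≤ x' v ℓ) ∧ (∀ v ℓ, x' v ℓ ≤ 1) ∧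
      (∀ v, ∑ ℓ, x' v ℓ = 1) ∧
      (∀ v ℓ, ∃ k : ℤ, x' v ℓ = (k : ℝ) / Q) ∧
      (∀ v ℓ, x' v ℓ ≤ 2 * x v ℓ) ∧
      (1 / 2) * (∑ u, ∑ v ∈ G.neighborFinset u, ∑ a, ∑ b,
          x' u a * x' v b * c (u, a) (v, b))
        ≤ (1 / 2) * (∑ u, ∑ v ∈ G.neighborFinset u, ∑ a, ∑ b,
          x u a * x v b * c (u, a) (v, b)) := by
  have hQ0 : (0 : ℝ) < Q := by exact_mod_cast hQ
  have hxnat : ∀ v ℓ, ∃ k : ℕ, x v ℓ = (k : ℝ) / (2 * Q) := by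
    intro v ℓ
    obtain ⟨k, hk⟩ := hxint v ℓ
    have hk0 : 0 ≤ k := by
      have h := hx0 v ℓ
      rw [hk, le_div_iff₀ (by positivity), zero_mul] at h
      exact_mod_cast h
    lift k to ℕ using hk0
    exact ⟨k, by simpa using hk⟩
  choose k hk using hxnat
  have hksum : ∀ v, ∑ ℓ, k v ℓ = 2 * Q := by
    intro v
    have h := hxsum v
    simp_rw [hk] at h
    rw [← Finset.sum_div, div_eq_one_iff_eq (by positivity)] at h
    exact_mod_cast h
  choose e hesum heven habs using fun v =>
    exists_balanced_parity_correction (k v) (by rw [hksum v]; exact even_two_mul Q)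
  let y : (V → ℤ) → V → L → ℝ := fun s v ℓ => ((k v ℓ : ℝ) + s v * e v ℓ) / (2 * Q)
  have hyx : y 0 = x := by
    funext v ℓ
    simp [y, hk]
  obtain ⟨s, hs, hle⟩ := exists_sign_vector_le
    (fun s => ∑ u, ∑ v ∈ G.neighborFinset u, ∑ a, ∑ b,
      y s u a * y s v b * c (u, a) (v, b)) (by
    intro s w
    simp only [Finset.mul_sum, ← Finset.sum_add_distrib]
    refine Finset.sum_congr rfl fun u _ => Finset.sum_congr rfl fun v hv =>
      Finset.sum_congr rfl fun a _ => Finset.sum_congr rfl fun b _ => ?_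
    have huv : u ≠ v := ((G.mem_neighborFinset u v).mp hv).ne
    simp only [y]
    rcases eq_or_ne u w with rfl | hu
    · simp only [Function.update_self, Function.update_of_ne huv.symm]
      push_cast
      ring
    · rcases eq_or_ne v w with rfl | hv
      · simp only [Function.update_self, Function.update_of_ne hu]
        push_cast
        ring
      · simp only [Function.update_of_ne hu, Function.update_of_ne hv]
        ring)
  have hbound : ∀ v ℓ, |s v * e v ℓ| ≤ (k v ℓ : ℤ) := by
    intro v ℓ
    rcases hs v with h | h <;> simpa [h] using habs v ℓ
  have hy0 : ∀ v ℓ, 0 ≤ y s v ℓ := by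
    intro v ℓ
    have h : 0 ≤ (k v ℓ : ℤ) + s v * e v ℓ := by linarith [(abs_le.mp (hbound v ℓ)).1]
    have h' : (0 : ℝ) ≤ (k v ℓ : ℝ) + s v * e v ℓ := by exact_mod_cast h
    exact div_nonneg h' (by positivity)
  have hysum : ∀ v, ∑ ℓ, y s v ℓ = 1 := by
    intro v
    have hk' : ∑ ℓ, (k v ℓ : ℝ) = 2 * Q := by exact_mod_cast hksum v
    have he' : ∑ ℓ, (e v ℓ : ℝ) = 0 := by exact_mod_cast hesum v
    simp only [y]
    rw [← Finset.sum_div, Finset.sum_add_distrib, ← Finset.mul_sum, hk', he', mul_zero, add_zero,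
      div_self (by positivity)]
  refine ⟨y s, hy0, fun v ℓ => ?_, hysum, fun v ℓ => ?_, fun v ℓ => ?_, ?_⟩
  · rw [← hysum v]
    exact Finset.single_le_sum (fun i _ => hy0 v i) (Finset.mem_univ ℓ)
  · have h : Even ((k v ℓ : ℤ) + s v * e v ℓ) := by
      have h₁ := heven v ℓ
      rcases hs v with h | h <;> rw [h] <;> grind
    obtain ⟨m, hm⟩ := h
    have hm' : (k v ℓ : ℝ) + s v * e v ℓ = m + m := by exact_mod_cast hm
    refine ⟨m, ?_⟩
    simp only [y, hm']
    field_simp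
    ring
  · have h : (k v ℓ : ℤ) + s v * e v ℓ ≤ 2 * k v ℓ := by
      linarith [(abs_le.mp (hbound v ℓ)).2]
    have h' : (k v ℓ : ℝ) + s v * e v ℓ ≤ 2 * k v ℓ := by exact_mod_cast h
    rw [hk v ℓ, ← mul_div_assoc]
    exact div_le_div_of_nonneg_right h' (by positivity)
  · simp only [hyx] at hle
    exact mul_le_mul_of_nonneg_left hle (by norm_num)
end

section
/- Let G = (V,E) be a finite simple graph, let 𝒞 be a finite color space partitioned into parts P_1, …, P_K, and suppose each vertex v has a nonempty list L_v ⊆ 𝒞. Then there exists an assignment of a part index ℓ_v ∈ {1,…,K} to each vertex v such that L_v ∩ P_{ℓ_v} ≠ ∅ for every v and ∑_{u∈V} d'(u)/|L_u ∩ P_{ℓ_u}| ≤ ∑_{u∈V} d(u)/|L_u|, where d(u) is the degree of u and d'(u) := |{v ∈ N(u) : ℓ_v = ℓ_u}| is the number of neighbors of u assigned the same part as u. -/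
/-- Resampling one coordinate preserves the sum over a product of finite sets, up to the number of
choices for that coordinate. -/
theorem card_mul_sum_piFinset_eq_sum_sum_update {V C : Type*} [Fintype V] [DecidableEq V]
    (L : V → Finset C) (u : V) (g : (V → C) → ℝ) :
    ((L u).card : ℝ) * ∑ c ∈ Fintype.piFinset L, g c =
      ∑ c ∈ Fintype.piFinset L, ∑ a ∈ L u, g (Function.update c u a) := by
  have h : ((L u).card : ℝ) * ∑ c ∈ Fintype.piFinset L, g c =
      ∑ x ∈ Fintype.piFinset L ×ˢ L u, g x.1 := by
    simp [Finset.sum_product, Finset.mul_sum]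
  have update_mem : ∀ x ∈ Fintype.piFinset L ×ˢ L u,
      (Function.update x.1 u x.2, x.1 u) ∈ Fintype.piFinset L ×ˢ L u := by
    intro x hx
    obtain ⟨hc, ha⟩ := Finset.mem_product.1 hx
    rw [Fintype.mem_piFinset] at hc
    refine Finset.mem_product.2 ⟨Fintype.mem_piFinset.2 fun v => ?_, hc u⟩
    by_cases hv : v = u
    · subst hv
      simpa using ha
    · simpa [hv] using hc v
  rw [h, ← Finset.sum_product' (f := fun c a => g (Function.update c u a))]
  exact Finset.sum_nbij' (fun x => (Function.update x.1 u x.2, x.1 u))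
    (fun x => (Function.update x.1 u x.2, x.1 u)) update_mem update_mem
    (by simp) (by simp) (by simp)

/-- For independent uniform choices `c w ∈ L w`, the expectation of the indicator of
`p (c v) = p (c u)` weighted by the inverse size of the class of `c u` in `L u` is at most
`1 / |L u|`. -/
theorem sum_piFinset_ite_inv_card_le {V C I : Type*} [Fintype V] [DecidableEq V] [DecidableEq I]
    (L : V → Finset C) (p : C → I) {u v : V} (huv : v ≠ u) (hu : (L u).Nonempty) :
    ∑ c ∈ Fintype.piFinset L,
        (if p (c v) = p (c u) then (((L u).filter (p · = p (c u))).card : ℝ)⁻¹ else 0) ≤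
      (Fintype.piFinset L).card * ((L u).card : ℝ)⁻¹ := by
  have hpos : (0 : ℝ) < (L u).card := by exact_mod_cast hu.card_pos
  rw [← div_eq_mul_inv, le_div_iff₀ hpos, mul_comm, card_mul_sum_piFinset_eq_sum_sum_update]
  refine (Finset.sum_le_card_nsmul _ _ 1 fun c _ => ?_).trans_eq (by simp)
  simp only [Function.update_of_ne huv, Function.update_self]
  calc ∑ a ∈ L u, (if p (c v) = p a then (((L u).filter (p · = p a)).card : ℝ)⁻¹ else 0)
      = ∑ a ∈ L u, (if p a = p (c v) then (((L u).filter (p · = p (c v))).card : ℝ)⁻¹ else 0) := by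
        refine Finset.sum_congr rfl fun a _ => ?_
        by_cases h : p a = p (c v)
        · simp [h]
        · simp [h, Ne.symm h]
    _ = ((L u).filter (p · = p (c v))).card * (((L u).filter (p · = p (c v))).card : ℝ)⁻¹ := by
        rw [← Finset.sum_filter, Finset.sum_const, nsmul_eq_mul]
    _ ≤ 1 := mul_inv_le_one

/-- Combinatorial core of the color-space partitioning step of Theorem 4.2.
For a partition `P_1, …, P_K` (K ≥ 1) of a finite color space and nonempty lists `L_v`,
there is an assignment `pt v` of a part to each vertex with `L_v ∩ P_{pt v} ≠ ∅` such
that the new potential `∑_u d'(u)/|L_u ∩ P_{pt u}|` is at most the old potential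
`∑_u d(u)/|L_u|`, where `d'(u)` counts the neighbors of `u` assigned the same part. -/
theorem exists_partition_assignment_potential_le
    {V C : Type*} [Fintype V] [DecidableEq V] [Fintype C] [DecidableEq C]
    (G : SimpleGraph V) [DecidableRel G.Adj]
    (K : ℕ) (hK : 0 < K) (P : Fin K → Finset C)
    (hdisj : ∀ i j, i ≠ j → Disjoint (P i) (P j))
    (hcover : ∀ x : C, ∃ i, x ∈ P i)
    (L : V → Finset C) (hne : ∀ v, (L v).Nonempty) :
    ∃ pt : V → Fin K,
      (∀ v, (L v ∩ P (pt v)).Nonempty) ∧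
      ∑ u, ((((G.neighborFinset u).filter (fun v => pt v = pt u)).card : ℝ)
          / ((L u ∩ P (pt u)).card : ℝ))
        ≤ ∑ u, (G.degree u : ℝ) / ((L u).card : ℝ) := by
  choose p hp using hcover
  have inter_eq : ∀ u i, L u ∩ P i = (L u).filter (p · = i) := by
    intro u i
    ext x
    simp only [Finset.mem_inter, Finset.mem_filter, and_congr_right_iff]
    refine fun _ => ⟨fun hx => ?_, fun hx => hx ▸ hp x⟩
    by_contra hxi
    exact Finset.disjoint_left.1 (hdisj _ _ hxi) (hp x) hx
  have hpi : (Fintype.piFinset L).Nonempty := Fintype.piFinset_nonempty.2 hne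
  obtain ⟨c, hc, hle⟩ := Finset.exists_le_of_sum_le (s := Fintype.piFinset L)
    (f := fun c => ∑ u, ∑ v ∈ G.neighborFinset u,
      (if p (c v) = p (c u) then (((L u).filter (p · = p (c u))).card : ℝ)⁻¹ else 0))
    (g := fun _ => ∑ u, (G.degree u : ℝ) / ((L u).card : ℝ)) hpi (by
      rw [Finset.sum_comm, Finset.sum_const, nsmul_eq_mul, Finset.mul_sum]
      refine Finset.sum_le_sum fun u _ => ?_
      rw [Finset.sum_comm]
      refine (Finset.sum_le_card_nsmul _ _ _ fun v hv =>
        sum_piFinset_ite_inv_card_le L p (?_ : v ≠ u) (hne u)).trans_eq ?_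
      · exact ((G.mem_neighborFinset u v).1 hv).ne'
      · rw [G.card_neighborFinset_eq_degree, nsmul_eq_mul]
        ring)
  refine ⟨fun v => p (c v), fun v => ⟨c v, ?_⟩, ?_⟩
  · exact Finset.mem_inter.2 ⟨Fintype.mem_piFinset.1 hc v, hp _⟩
  · refine le_trans (le_of_eq ?_) hle
    refine Finset.sum_congr rfl fun u _ => ?_
    rw [← Finset.sum_filter, Finset.sum_const, nsmul_eq_mul, inter_eq, div_eq_mul_inv]
end

section
/- Let K and H be positive integers, let ρ := 2^{−⌈log₂(10·K·H)⌉}, and let x : {1,…,K} → ℝ satisfy x(ℓ) ≥ 0 for all ℓ and ∑_{ℓ=1}^{K} x(ℓ) = 1. Then there exists x'' : {1,…,K} → ℝ such that every x''(ℓ) is a non-negative integer multiple of ρ, ∑_{ℓ=1}^{K} x''(ℓ) = 1, and x''(ℓ) ≤ (1 + 1/(4H)) · x(ℓ) for every ℓ ∈ {1,…,K}. -/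
/-- A function with natural values can be decreased pointwise to attain any smaller sum. -/
theorem exists_le_sum_eq {ι : Type*} [Fintype ι] (c : ι → ℕ) (n : ℕ) (hn : n ≤ ∑ i, c i) :
    ∃ k ≤ c, ∑ i, k i = n := by
  classical
  induction n with
  | zero => exact ⟨0, fun _ => Nat.zero_le _, by simp⟩
  | succ n ih =>
    obtain ⟨k, hkc, hk⟩ := ih (by omega)
    obtain ⟨i, -, hi⟩ := Finset.exists_lt_of_sum_lt (s := Finset.univ) (f := k) (g := c) (by omega)
    refine ⟨k + Pi.single i 1, fun j => ?_, by simp [Finset.sum_add_distrib, hk]⟩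
    by_cases hj : j = i
    · subst hj
      simpa using hi
    · simpa [hj] using hkc j

/-- If scaling `x` increases its sum to at least `N + card ι`, then integers below the scaled
values can be chosen with sum exactly `N`. -/
theorem exists_nat_le_mul_sum_eq {ι : Type*} [Fintype ι] (x : ι → ℝ) (hx : ∀ i, 0 ≤ x i)
    (N : ℕ) {a : ℝ} (ha : 0 ≤ a) (hN : (N : ℝ) + Fintype.card ι ≤ a * ∑ i, x i) :
    ∃ k : ι → ℕ, (∀ i, (k i : ℝ) ≤ a * x i) ∧ ∑ i, k i = N := by
  have hsum : N ≤ ∑ i, ⌊a * x i⌋₊ := by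
    have h : a * ∑ i, x i ≤ ∑ i, ((⌊a * x i⌋₊ : ℝ) + 1) := by
      rw [Finset.mul_sum]
      exact Finset.sum_le_sum fun i _ => (Nat.lt_floor_add_one _).le
    rw [Finset.sum_add_distrib] at h
    simp only [Finset.sum_const, Finset.card_univ, nsmul_eq_mul, mul_one] at h
    have h' : (N : ℝ) ≤ ∑ i, (⌊a * x i⌋₊ : ℝ) := by linarith
    exact_mod_cast h'
  obtain ⟨k, hk, hkN⟩ := exists_le_sum_eq _ N hsum
  exact ⟨k, fun i => (Nat.cast_le.2 (hk i)).trans (Nat.floor_le (mul_nonneg ha (hx i))), hkN⟩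


/-- Perturbation step of Theorem 4.2. For positive integers `K, H` and
`ρ = 2^{-⌈log₂(10KH)⌉}`, every probability vector `x` on `{1, …, K}` can be perturbed to
a probability vector `x''` all of whose entries are non-negative integer multiples of
`ρ`, with `x'' ℓ ≤ (1 + 1/(4H)) · x ℓ` for every `ℓ`. -/
theorem rho_integral_perturbation
    (K H : ℕ) (hK : 0 < K) (hH : 0 < H)
    (x : Fin K → ℝ) (hx0 : ∀ ℓ, 0 ≤ x ℓ) (hx1 : ∑ ℓ, x ℓ = 1) :
    ∃ x'' : Fin K → ℝ,
      (∀ ℓ, ∃ k : ℕ, x'' ℓ = (k : ℝ) * ((2 : ℝ) ^ (Nat.clog 2 (10 * K * H)))⁻¹) ∧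
      (∑ ℓ, x'' ℓ = 1) ∧
      (∀ ℓ, x'' ℓ ≤ (1 + 1 / (4 * (H : ℝ))) * x ℓ) := by
  set N : ℕ := 2 ^ Nat.clog 2 (10 * K * H) with hNdef
  have hN : (10 * K * H : ℝ) ≤ N := by
    exact_mod_cast Nat.le_pow_clog one_lt_two (10 * K * H)
  have hcast : (2 : ℝ) ^ Nat.clog 2 (10 * K * H) = N := by simp [hNdef]
  have hH' : (0 : ℝ) < H := by exact_mod_cast hH
  have hK' : (0 : ℝ) < K := by exact_mod_cast hK
  have hN' : (0 : ℝ) < N := lt_of_lt_of_le (by positivity) hN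
  have hslack : (K : ℝ) ≤ N * (1 / (4 * (H : ℝ))) := by
    rw [mul_one_div, le_div_iff₀ (by positivity)]
    nlinarith [mul_pos hK' hH']
  obtain ⟨k, hk, hkN⟩ := exists_nat_le_mul_sum_eq x hx0 N
    (a := N * (1 + 1 / (4 * (H : ℝ)))) (by positivity)
    (by rw [hx1, Fintype.card_fin]; linarith)
  rw [hcast]
  refine ⟨fun ℓ => k ℓ * (N : ℝ)⁻¹, fun ℓ => ⟨k ℓ, rfl⟩, ?_, fun ℓ => ?_⟩
  · rw [← Finset.sum_mul, ← Nat.cast_sum, hkN, mul_inv_cancel₀ hN'.ne']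
  · refine (mul_inv_le_iff₀ hN').2 ?_
    linarith [hk ℓ]
end

section
/- Let a ≥ 1 be a real number, let ε > 0, and let G = (V,E) be a finite simple graph with n ≥ 1 vertices such that every nonempty subset S ⊆ V spans at most a·|S| edges (i.e. G has arboricity-type density at most a). Then there exists an integer h ≤ ⌈log n / log((2+ε)/2)⌉ + 1 and a partition of V into layers V_1, …, V_h such that every vertex v ∈ V_i has at most (2+ε)·a neighbors in V_i ∪ V_{i+1} ∪ … ∪ V_h. -/
/-- The vertices that survive `i` rounds of removing every vertex with at most `d` remaining
neighbors. -/
noncomputable def SimpleGraph.peel {V : Type*} [Fintype V] [DecidableEq V]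
    (G : SimpleGraph V) [DecidableRel G.Adj] (d : ℝ) : ℕ → Finset V
  | 0 => Finset.univ
  | i + 1 => {v ∈ G.peel d i | d < ((G.neighborFinset v ∩ G.peel d i).card : ℝ)}

/-- The handshake lemma for the subgraph spanned by a vertex subset. -/
theorem SimpleGraph.sum_card_neighborFinset_inter {V : Type*} [Fintype V] [DecidableEq V]
    (G : SimpleGraph V) [DecidableRel G.Adj] (S : Finset V) :
    ∑ v ∈ S, (G.neighborFinset v ∩ S).card = 2 * (G.edgeFinset ∩ S.sym2).card := by
  classical
  let H : SimpleGraph V :=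
    { Adj := fun u v => G.Adj u v ∧ u ∈ S ∧ v ∈ S
      symm := ⟨fun u v h => ⟨h.1.symm, h.2.2, h.2.1⟩⟩
      loopless := ⟨fun u h => G.irrefl h.1⟩ }
  have hE : H.edgeFinset = G.edgeFinset ∩ S.sym2 := by
    ext e
    induction e with
    | _ u v => simp [H]
  rw [← hE, ← H.sum_degrees_eq_twice_card_edges]
  refine Finset.sum_subset_zero_on_sdiff (Finset.subset_univ S) (fun v hv => ?_) fun v hv => ?_
  · have hvS : v ∉ S := by simpa using hv
    rw [← H.card_neighborFinset_eq_degree, Finset.card_eq_zero]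
    ext u
    simp [H, hvS]
  · rw [← H.card_neighborFinset_eq_degree]
    congr 1
    ext u
    simp [H, hv]

/-- A peeling round at threshold `d` shrinks the vertex set by a factor of at least `d / (2 * a)`
if the density is at most `a`. -/
theorem SimpleGraph.mul_card_peel_succ_le {V : Type*} [Fintype V] [DecidableEq V]
    (G : SimpleGraph V) [DecidableRel G.Adj] {a : ℝ} (d : ℝ)
    (hdens : ∀ S : Finset V, S.Nonempty →
      ((G.edgeFinset ∩ S.sym2).card : ℝ) ≤ a * S.card) (i : ℕ) :
    d * ((G.peel d (i + 1)).card : ℝ) ≤ 2 * a * (G.peel d i).card := by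
  have hS : ((G.edgeFinset ∩ (G.peel d i).sym2).card : ℝ) ≤ a * (G.peel d i).card := by
    rcases (G.peel d i).eq_empty_or_nonempty with h | h
    · simp [h]
    · exact hdens _ h
  have hsub : G.peel d (i + 1) ⊆ G.peel d i := Finset.filter_subset _ _
  calc d * ((G.peel d (i + 1)).card : ℝ)
      = ∑ v ∈ G.peel d (i + 1), d := by simp [mul_comm]
    _ ≤ ∑ v ∈ G.peel d (i + 1), ((G.neighborFinset v ∩ G.peel d i).card : ℝ) :=
        Finset.sum_le_sum fun v hv => (Finset.mem_filter.mp hv).2.le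
    _ ≤ ∑ v ∈ G.peel d i, ((G.neighborFinset v ∩ G.peel d i).card : ℝ) :=
        Finset.sum_le_sum_of_subset_of_nonneg hsub fun _ _ _ => Nat.cast_nonneg _
    _ = 2 * ((G.edgeFinset ∩ (G.peel d i).sym2).card : ℝ) := by
        exact_mod_cast G.sum_card_neighborFinset_inter _
    _ ≤ 2 * a * (G.peel d i).card := by linarith

/-- If peeling at threshold `d` ends within `h` rounds, then the rounds in which the vertices are
removed form a layering in which every vertex has at most `d` neighbors in its own or higher
layers. -/
theorem SimpleGraph.exists_layer_of_peel_eq_empty {V : Type*} [Fintype V] [DecidableEq V]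
    (G : SimpleGraph V) [DecidableRel G.Adj] {d : ℝ} {h : ℕ} (hh : G.peel d h = ∅) :
    ∃ layer : V → Fin h, ∀ v : V,
      (((G.neighborFinset v).filter (fun u => layer v ≤ layer u)).card : ℝ) ≤ d := by
  have hex : ∀ v, ∃ i, v ∉ G.peel d (i + 1) := fun v =>
    ⟨h, fun hv => by simpa [hh] using (Finset.mem_filter.mp hv).1⟩
  have hmem : ∀ u i, i ≤ Nat.find (hex u) → u ∈ G.peel d i := by
    rintro u (_ | i) hi
    · exact Finset.mem_univ u
    · exact not_not.mp (Nat.find_min (hex u) hi)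
  have hlt : ∀ v, Nat.find (hex v) < h := fun v => by
    by_contra! hle
    simpa [hh] using hmem v h hle
  refine ⟨fun v => ⟨Nat.find (hex v), hlt v⟩, fun v => ?_⟩
  have hdeg : ((G.neighborFinset v ∩ G.peel d (Nat.find (hex v))).card : ℝ) ≤ d := by
    by_contra! hgt
    exact Nat.find_spec (hex v) (Finset.mem_filter.mpr ⟨hmem v _ le_rfl, hgt⟩)
  refine le_trans (Nat.cast_le.mpr (Finset.card_le_card fun u hu => ?_)) hdeg
  obtain ⟨hu, hle⟩ := Finset.mem_filter.mp hu
  exact Finset.mem_inter.mpr ⟨hu, hmem u _ hle⟩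


/-- The peeling construction of an H-partition. If every nonempty vertex
subset `S` of a finite simple graph on `n ≥ 1` vertices spans at most `a·|S|` edges,
then for every `ε > 0` there is a partition of the vertices into
`h ≤ ⌈log n / log((2+ε)/2)⌉ + 1` layers such that every vertex has at most `(2+ε)·a`
neighbors in its own or higher layers. -/
theorem H_partition_of_bounded_density
    {V : Type*} [Fintype V] [Nonempty V] [DecidableEq V]
    (G : SimpleGraph V) [DecidableRel G.Adj]
    (a : ℝ) (ha : 1 ≤ a) (ε : ℝ) (hε : 0 < ε)
    (hdens : ∀ S : Finset V, S.Nonempty →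
      ((G.edgeFinset ∩ S.sym2).card : ℝ) ≤ a * S.card) :
    ∃ h : ℕ,
      (h : ℤ) ≤ ⌈Real.log (Fintype.card V) / Real.log ((2 + ε) / 2)⌉ + 1 ∧
      ∃ layer : V → Fin h, ∀ v : V,
        (((G.neighborFinset v).filter (fun u => layer v ≤ layer u)).card : ℝ)
          ≤ (2 + ε) * a := by
  have ha0 : 0 < a := by linarith
  obtain ⟨q, rfl⟩ : ∃ q, ε = 2 * q - 2 := ⟨(2 + ε) / 2, by ring⟩
  have hq : 1 < q := by linarith
  rw [show (2 + (2 * q - 2)) / 2 = q by ring, show 2 + (2 * q - 2) = 2 * q by ring]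
  have hn : (0 : ℝ) < Fintype.card V := by exact_mod_cast Fintype.card_pos
  have hlogq : 0 < Real.log q := Real.log_pos hq
  have hratio : 0 ≤ Real.log (Fintype.card V) / Real.log q :=
    div_nonneg (Real.log_natCast_nonneg _) hlogq.le
  set k := ⌈Real.log (Fintype.card V) / Real.log q⌉₊ with hk
  have hstep : ∀ i, q ^ i * ((G.peel (2 * q * a) i).card : ℝ) ≤ Fintype.card V := by
    intro i
    induction i with
    | zero => simp [SimpleGraph.peel]
    | succ i ih =>
      have hround : q * ((G.peel (2 * q * a) (i + 1)).card : ℝ) ≤ (G.peel (2 * q * a) i).card := by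
        have := G.mul_card_peel_succ_le (2 * q * a) hdens i
        refine le_of_mul_le_mul_left ?_ (by positivity : 0 < 2 * a)
        linarith
      calc q ^ (i + 1) * ((G.peel (2 * q * a) (i + 1)).card : ℝ)
          = q ^ i * (q * (G.peel (2 * q * a) (i + 1)).card) := by ring
        _ ≤ q ^ i * (G.peel (2 * q * a) i).card := by gcongr
        _ ≤ Fintype.card V := ih
  have hpow : (Fintype.card V : ℝ) ≤ q ^ k := by
    rw [← Real.log_le_log_iff hn (by positivity), Real.log_pow, ← div_le_iff₀ hlogq]
    exact Nat.le_ceil _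
  have hempty : G.peel (2 * q * a) (k + 1) = ∅ := by
    by_contra hne
    have hcard : (1 : ℝ) ≤ (G.peel (2 * q * a) (k + 1)).card := by
      exact_mod_cast Finset.card_pos.mpr (Finset.nonempty_iff_ne_empty.mpr hne)
    have hlt : q ^ k < q ^ (k + 1) := pow_lt_pow_right₀ hq k.lt_succ_self
    have hle : q ^ (k + 1) ≤ q ^ (k + 1) * ((G.peel (2 * q * a) (k + 1)).card : ℝ) :=
      le_mul_of_one_le_right (by positivity) hcard
    linarith [hstep (k + 1)]
  refine ⟨k + 1, ?_, G.exists_layer_of_peel_eq_empty hempty⟩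
  rw [Nat.cast_add_one, hk, Int.natCast_ceil_eq_ceil hratio]
end
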